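/- Let E ⊆ ℝ be a trim G_δ set. Then there exists a continuous function f : ℝ → ℝ such that L_f^∞ = E, l_f^∞ = ∅, and moreover lip f(x) = 0 for every x ∈ E. -/

import Mathlib

open Set Filter MeasureTheory Topology
open scoped ENNReal NNReal

/-- `M_f(x,r) = sup { |f(x)-f(y)|/r : |x-y| ≤ r }`, valued in `[0,∞]`. -/
noncomputable def Mf (f : ℝ → ℝ) (x r : ℝ) : ℝ≥0∞ :=
  ⨆ y ∈ {y : ℝ | |x - y| ≤ r}, ENNReal.ofReal (|f x - f y| / r)

/-- The big Lip function: `Lip f(x) = limsup_{r→0⁺} M_f(x,r)`. -/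
noncomputable def bigLip (f : ℝ → ℝ) (x : ℝ) : ℝ≥0∞ :=
  Filter.limsup (fun r => Mf f x r) (𝓝[>] (0 : ℝ))

/-- The little lip function: `lip f(x) = liminf_{r→0⁺} M_f(x,r)`. -/
noncomputable def litLip (f : ℝ → ℝ) (x : ℝ) : ℝ≥0∞ :=
  Filter.liminf (fun r => Mf f x r) (𝓝[>] (0 : ℝ))

/-- A set `E ⊆ ℝ` is trim if `λ(E ∩ (a,b)) < b - a` for every open interval `(a,b)`. -/
def Trim (E : Set ℝ) : Prop :=
  ∀ a b : ℝ, a < b → volume (E ∩ Ioo a b) < ENNReal.ofReal (b - a)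

/-- The complement of a trim set has positive measure in every interval; a Lipschitz step
function which is locally constant at every point of `E`. -/
theorem exists_step (E : Set ℝ) (hE : MeasurableSet E) (hT : Trim E) (p q : ℝ) (hpq : p < q) :
    ∃ ψ : ℝ → ℝ, (∃ C : ℝ, 0 ≤ C ∧ ∀ y z, |ψ y - ψ z| ≤ C * |y - z|) ∧
      (∀ y, 0 ≤ ψ y ∧ ψ y ≤ 1) ∧ (∀ y ≤ p, ψ y = 0) ∧ (∀ y, q ≤ y → ψ y = 1) ∧
      (∀ x ∈ E, ∀ᶠ z in 𝓝 x, ψ z = ψ x) := by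
  have hpos : 0 < volume (Eᶜ ∩ Ioo p q) := by
    by_contra hcon
    have h0 : volume (Eᶜ ∩ Ioo p q) = 0 := by simpa using hcon
    have h1 := hT p q hpq
    have h2 : volume (Ioo p q) ≤ volume (E ∩ Ioo p q) + volume (Eᶜ ∩ Ioo p q) := by
      refine le_trans (measure_mono ?_) (measure_union_le _ _)
      intro x hx
      by_cases hxE : x ∈ E
      · exact Or.inl ⟨hxE, hx⟩
      · exact Or.inr ⟨hxE, hx⟩
    rw [h0, add_zero, Real.volume_Ioo] at h2
    exact absurd h1 (not_lt.mpr h2)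
  obtain ⟨K, hKs, hKc, hKpos⟩ :=
    (hE.compl.inter measurableSet_Ioo).exists_lt_isCompact hpos
  have hfin : ∀ s : Set ℝ, volume (K ∩ s) ≠ ⊤ := fun s =>
    ne_top_of_le_ne_top hKc.measure_lt_top.ne (measure_mono inter_subset_left)
  set k := volume.real K with hk
  have hk0 : 0 < k := ENNReal.toReal_pos hKpos.ne' hKc.measure_lt_top.ne
  have hmono : ∀ y z, y ≤ z → volume.real (K ∩ Iic z) - volume.real (K ∩ Iic y) ≤ z - y ∧
      volume.real (K ∩ Iic y) ≤ volume.real (K ∩ Iic z) := by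
    intro y z hyz
    have hsub : K ∩ Iic z ⊆ (K ∩ Iic y) ∪ Ioc y z := by
      intro t ht
      rcases le_or_gt t y with h | h
      · exact Or.inl ⟨ht.1, h⟩
      · exact Or.inr ⟨h, ht.2⟩
    constructor
    · have h1 : volume.real (K ∩ Iic z) ≤ volume.real (K ∩ Iic y) + volume.real (Ioc y z) := by
        refine le_trans (measureReal_mono hsub ?_) (measureReal_union_le _ _)
        exact (lt_of_le_of_lt (measure_union_le _ _)
          (ENNReal.add_lt_top.mpr ⟨(hfin _).lt_top, by simp⟩)).ne
      have h2 : volume.real (Ioc y z) = z - y := by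
        rw [Real.volume_real_Ioc_of_le hyz]
      linarith
    · exact measureReal_mono (by gcongr) (hfin _)
  refine ⟨fun y => volume.real (K ∩ Iic y) / k, ⟨1 / k, by positivity, ?_⟩, ?_, ?_, ?_, ?_⟩
  · intro y z
    rw [← sub_div, abs_div, abs_of_pos hk0, one_div, inv_mul_eq_div]
    refine div_le_div_of_nonneg_right ?_ hk0.le
    rcases le_total y z with h | h
    · have := hmono y z h
      rw [abs_sub_comm, abs_of_nonneg (by linarith), abs_sub_comm, abs_of_nonneg (by linarith)]
      exact this.1
    · have := hmono z y h
      rw [abs_of_nonneg (by linarith), abs_of_nonneg (by linarith)]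
      exact this.1
  · intro y
    refine ⟨by positivity, ?_⟩
    rw [div_le_one hk0]
    exact measureReal_mono inter_subset_left hKc.measure_lt_top.ne
  · intro y hy
    have : K ∩ Iic y = ∅ := by
      ext t
      simp only [mem_inter_iff, mem_Iic, mem_empty_iff_false, iff_false, not_and, not_le]
      intro ht
      exact lt_of_le_of_lt hy (hKs ht).2.1
    simp [this]
  · intro y hy
    have : K ∩ Iic y = K := by
      apply inter_eq_left.mpr
      intro t ht
      exact (hKs ht).2.2.le.trans hy
    simp only [this]
    exact div_self hk0.ne'
  · intro x hx
    have hxK : x ∈ Kᶜ := fun h => (hKs h).1 hx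
    obtain ⟨ε, hε, hball⟩ := Metric.isOpen_iff.mp hKc.isClosed.isOpen_compl x hxK
    filter_upwards [Metric.ball_mem_nhds x hε] with z hz
    have : K ∩ Iic z = K ∩ Iic x := by
      ext t
      simp only [mem_inter_iff, mem_Iic, and_congr_right_iff]
      intro ht
      have h1 : t ∉ Metric.ball x ε := fun h => hball h ht
      rw [Real.ball_eq_Ioo, mem_Ioo] at h1 hz
      by_contra hcon
      apply h1
      grind
    simp only [this]

theorem exists_bump (E : Set ℝ) (hE : MeasurableSet E) (hT : Trim E) (a b h : ℝ) (hab : a < b)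
    (hh : 0 ≤ h) :
    ∃ φ : ℝ → ℝ, (∃ C : ℝ, ∀ y z, |φ y - φ z| ≤ C * |y - z|) ∧
      (∀ y, 0 ≤ φ y ∧ φ y ≤ h) ∧
      (∀ y, φ y ≠ 0 → a + (b - a) / 3 ≤ y ∧ y ≤ b - (b - a) / 3) ∧
      (∃ y ∈ Ioo a b, φ y = h) ∧
      (∀ x ∈ E, ∀ᶠ z in 𝓝 x, φ z = φ x) := by
  obtain ⟨ψ, ⟨C, hC0, hC⟩, h01, hl, hr, hloc⟩ :=
    exists_step E hE hT (a + (b - a) / 3) ((a + b) / 2) (by linarith)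
  obtain ⟨ψ', ⟨C', hC0', hC'⟩, h01', hl', hr', hloc'⟩ :=
    exists_step E hE hT ((a + b) / 2) (b - (b - a) / 3) (by linarith)
  refine ⟨fun y => h * (ψ y - ψ' y), ⟨h * (C + C'), ?_⟩, ?_, ?_, ?_, ?_⟩
  · intro y z
    have : h * (ψ y - ψ' y) - h * (ψ z - ψ' z) = h * ((ψ y - ψ z) - (ψ' y - ψ' z)) := by ring
    rw [this, abs_mul, abs_of_nonneg hh, mul_assoc]
    gcongr
    have h1 := hC y z
    have h2 := hC' y z
    have h3 := abs_sub (ψ y - ψ z) (ψ' y - ψ' z)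
    linarith
  · intro y
    have h1 := h01 y
    have h2 := h01' y
    have h3 : 0 ≤ ψ y - ψ' y := by
      rcases le_total y ((a + b) / 2) with h | h
      · rw [hl' y h]; linarith
      · rw [hr y h]; linarith
    exact ⟨mul_nonneg hh h3, mul_le_of_le_one_right hh (by linarith)⟩
  · intro y hy
    constructor
    · by_contra hcon
      push Not at hcon
      apply hy
      simp only
      rw [hl y hcon.le, hl' y (by linarith)]; simp
    · by_contra hcon
      push Not at hcon
      apply hy
      simp only
      rw [hr y (by linarith), hr' y (by linarith)]; simp
  · refine ⟨(a + b) / 2, ⟨by linarith, by linarith⟩, ?_⟩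
    simp only
    rw [hr _ le_rfl, hl' _ le_rfl]; simp
  · intro x hx
    filter_upwards [hloc x hx, hloc' x hx] with z h1 h2
    rw [h1, h2]

theorem exists_notMem (E : Set ℝ) (hT : Trim E) (p q : ℝ) (hpq : p < q) :
    ∃ x ∈ Ioo p q, x ∉ E := by
  by_contra! hcon
  have h1 := hT p q hpq
  rw [inter_eq_right.mpr hcon, Real.volume_Ioo] at h1
  exact lt_irrefl _ h1

/-- Uniformly spread closed set avoiding `E`. -/
theorem exists_net (E : Set ℝ) (hT : Trim E) (ε : ℝ) (hε : 0 < ε) :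
    ∃ Q : Set ℝ, IsClosed Q ∧ (∀ x ∈ Q, x ∉ E) ∧ ∀ x : ℝ, (∃ q ∈ Q, x < q ∧ q < x + 2 * ε) ∧
      (∃ q ∈ Q, x - 2 * ε < q ∧ q < x) := by
  have hch : ∀ j : ℤ, ∃ x ∈ Ioo (j * ε) (j * ε + ε / 2), x ∉ E := fun j =>
    exists_notMem E hT _ _ (by linarith)
  choose q hq hqE using hch
  refine ⟨range q, ?_, ?_, ?_⟩
  · refine (Metric.isClosedEmbedding_of_pairwise_le_dist (ε := ε / 2) (by positivity) ?_).isClosed_range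
    have key : ∀ i j : ℤ, i < j → ε / 2 ≤ dist (q i) (q j) := by
      intro i j hij
      have h1 := (hq i).2
      have h2 := (hq j).1
      have h3 : (i : ℝ) + 1 ≤ j := by exact_mod_cast hij
      have h4 : ((i : ℝ) + 1) * ε ≤ j * ε := by gcongr
      rw [Real.dist_eq, abs_sub_comm]
      refine le_trans ?_ (le_abs_self _)
      linarith
    intro i j hij
    rcases lt_or_gt_of_ne hij with h | h
    · exact key i j h
    · have := key j i h
      rw [dist_comm] at this
      exact this
  · rintro _ ⟨j, rfl⟩; exact hqE j
  · intro x
    have h1 := Int.floor_le (x / ε)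
    have h2 := Int.lt_floor_add_one (x / ε)
    rw [le_div_iff₀ hε] at h1
    rw [div_lt_iff₀ hε] at h2
    refine ⟨⟨q (⌊x / ε⌋ + 1), mem_range_self _, ?_⟩, ⟨q (⌊x / ε⌋ - 1), mem_range_self _, ?_⟩⟩
    · have h3 := hq (⌊x / ε⌋ + 1)
      push_cast at h3
      constructor <;> linarith [h3.1, h3.2]
    · have h3 := hq (⌊x / ε⌋ - 1)
      push_cast at h3
      constructor <;> linarith [h3.1, h3.2]

theorem exists_P (E : Set ℝ) (hT : Trim E) (d : ℝ → ℝ) (hd : ∀ x y, d x ≤ d y + |x - y|)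
    (hdc : Continuous d)
    (h0 : ∀ x, 0 ≤ d x) (h1 : ∀ x, d x ≤ 1) (hE : ∀ x ∈ E, 0 < d x) (δ : ℝ) (hδ : 0 < δ)
    (hδ1 : δ ≤ 1) :
    ∃ P : Set ℝ, IsClosed P ∧ (∀ x ∈ P, x ∉ E) ∧ (∀ x, d x = 0 → x ∈ P) ∧
      ∀ x, 0 < d x → ∃ p ∈ P, ∃ p' ∈ P, p < x ∧ x < p' ∧ p' - p ≤ δ * d x := by
  have hch := fun k : ℕ => exists_net E hT (δ * (1 / 2) ^ k / 8) (by positivity)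
  choose Q hQc hQE hQ using hch
  refine ⟨{x | d x = 0} ∪ ⋃ k, (Q k ∩ {x | d x ≤ 2 * (1 / 2) ^ k}), ?_, ?_, ?_, ?_⟩
  · have : ({x | d x = 0} ∪ ⋃ k, (Q k ∩ {x | d x ≤ 2 * (1 / 2) ^ k})) =
        ⋂ K : ℕ, ((⋃ k ∈ Finset.range (K + 1), (Q k ∩ {x | d x ≤ 2 * (1 / 2) ^ k})) ∪
          {x | d x ≤ (1 / 2) ^ K}) := by
      ext x
      constructor
      · rintro (hx | hx)
        · refine mem_iInter.mpr fun K => Or.inr ?_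
          rw [mem_ofPred_eq] at hx ⊢
          rw [hx]; positivity
        · obtain ⟨k, hk⟩ := mem_iUnion.mp hx
          refine mem_iInter.mpr fun K => ?_
          rcases le_or_gt k K with h | h
          · left
            simp only [mem_iUnion]
            exact ⟨k, Finset.mem_range.mpr (by omega), hk⟩
          · right
            have hk2 : d x ≤ 2 * (1 / 2) ^ k := hk.2
            refine le_trans hk2 ?_
            obtain ⟨m, rfl⟩ : ∃ m, k = m + 1 := ⟨k - 1, by omega⟩
            have : ((1 : ℝ) / 2) ^ m ≤ (1 / 2) ^ K :=
              pow_le_pow_of_le_one (by norm_num) (by norm_num) (by omega)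
            rw [pow_succ]; linarith
      · intro hx
        rw [mem_iInter] at hx
        rcases (h0 x).eq_or_lt with h | h
        · exact Or.inl h.symm
        · obtain ⟨K, hK⟩ := exists_pow_lt_of_lt_one h (by norm_num : (1 / 2 : ℝ) < 1)
          rcases hx K with h2 | h2
          · right
            simp only [mem_iUnion] at h2 ⊢
            obtain ⟨k, _, hk⟩ := h2
            exact ⟨k, hk⟩
          · exact absurd h2 (not_le.mpr hK)
    rw [this]
    refine isClosed_iInter fun K => IsClosed.union ?_ (isClosed_le hdc continuous_const)
    refine Set.Finite.isClosed_biUnion (Finset.finite_toSet _) fun k _ => ?_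
    exact (hQc k).inter (isClosed_le hdc continuous_const)
  · rintro x (hx | hx) hxE
    · exact (hE x hxE).ne' hx
    · obtain ⟨k, hk⟩ := mem_iUnion.mp hx
      exact hQE k x hk.1 hxE
  · intro x hx; exact Or.inl hx
  · intro x hx
    obtain ⟨k, hk1, hk2⟩ : ∃ k : ℕ, (1 / 2 : ℝ) ^ (k + 1) < d x ∧ d x ≤ (1 / 2) ^ k :=
      exists_nat_pow_near_of_lt_one hx (h1 x) (by norm_num) (by norm_num)
    rw [pow_succ] at hk1
    have hkp : (0 : ℝ) < (1 / 2) ^ k := by positivity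
    obtain ⟨⟨p', hp', h3, h4⟩, ⟨p, hp, h5, h6⟩⟩ := hQ k x
    have hδk : δ * (1 / 2) ^ k ≤ (1 / 2) ^ k := mul_le_of_le_one_left hkp.le hδ1
    refine ⟨p, Or.inr (mem_iUnion.mpr ⟨k, hp, ?_⟩), p', Or.inr (mem_iUnion.mpr ⟨k, hp', ?_⟩),
      h6, h3, ?_⟩
    · have := hd p x
      rw [abs_sub_comm, abs_of_pos (by linarith)] at this
      rw [mem_ofPred_eq]; linarith
    · have := hd p' x
      rw [abs_of_pos (by linarith)] at this
      rw [mem_ofPred_eq]; linarith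
    · have : δ * ((1 / 2) ^ k * (1 / 2)) ≤ δ * d x := by gcongr
      linarith

theorem exists_gap (P : Set ℝ) (hP : IsClosed P) (x p p' : ℝ) (hp : p ∈ P) (hp' : p' ∈ P)
    (h1 : p < x) (h2 : x < p') (hx : x ∉ P) :
    ∃ a ∈ P, ∃ b ∈ P, p ≤ a ∧ b ≤ p' ∧ a < x ∧ x < b ∧ ∀ z ∈ Ioo a b, z ∉ P := by
  have hA : IsCompact (P ∩ Icc p x) := isCompact_Icc.inter_left hP
  have hB : IsCompact (P ∩ Icc x p') := isCompact_Icc.inter_left hP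
  obtain ⟨a, ha, hamax⟩ := hA.exists_isGreatest ⟨p, hp, le_rfl, h1.le⟩
  obtain ⟨b, hb, hbmin⟩ := hB.exists_isLeast ⟨p', hp', h2.le, le_rfl⟩
  refine ⟨a, ha.1, b, hb.1, ha.2.1, hb.2.2, lt_of_le_of_ne ha.2.2 ?_,
    lt_of_le_of_ne hb.2.1 ?_, ?_⟩
  · rintro rfl; exact hx ha.1
  · rintro rfl; exact hx hb.1
  · intro z hz hzP
    rcases le_total z x with h | h
    · exact absurd (hamax ⟨hzP, ha.2.1.trans hz.1.le, h⟩) (not_le.mpr hz.1)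
    · exact absurd (hbmin ⟨hzP, h, hz.2.le.trans hb.2.2⟩) (not_le.mpr hz.2)

theorem exists_next (E : Set ℝ) (hE : MeasurableSet E) (hT : Trim E) (U O : Set ℝ)
    (hU : IsOpen U) (hEU : E ⊆ U) (hUn : Uᶜ.Nonempty) (hO : IsOpen O) (hEO : E ⊆ O)
    (c N : ℝ) (hc : 0 < c) (hc1 : c ≤ 1) (hN : 0 ≤ N) :
    ∃ (g : ℝ → ℝ) (V : Set ℝ), IsOpen V ∧ E ⊆ V ∧ V ⊆ U ∧ V ⊆ O ∧ Vᶜ.Nonempty ∧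
      (∀ y, |g y| ≤ c ∧ |g y| ≤ c * Metric.infDist y Uᶜ) ∧
      (∀ x, ∃ C, ∀ᶠ y in 𝓝 x, |g y - g x| ≤ C * |y - x|) ∧
      (∀ x ∈ V, ∀ᶠ z in 𝓝 x, g z = g x) ∧
      (∀ x ∈ E, ∃ a b, a < x ∧ x < b ∧ b - a ≤ c ∧ Ioo a b ⊆ U ∧ a ∉ V ∧ b ∉ V ∧
        ∃ y ∈ Ioo a b, N * (b - a) ≤ |g y - g x|) := by
  set d : ℝ → ℝ := fun x => min 1 (Metric.infDist x Uᶜ) with hd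
  have hd0 : ∀ x, 0 ≤ d x := fun x => le_min zero_le_one Metric.infDist_nonneg
  have hd1 : ∀ x, d x ≤ 1 := fun x => min_le_left _ _
  have hdU : ∀ x, d x = 0 ↔ x ∉ U := by
    intro x
    have h1 : x ∈ Uᶜ ↔ Metric.infDist x Uᶜ = 0 := hU.isClosed_compl.mem_iff_infDist_zero hUn
    rw [← mem_compl_iff, h1, hd]
    have := Metric.infDist_nonneg (x := x) (s := Uᶜ)
    constructor
    · intro h
      rcases min_choice (1 : ℝ) (Metric.infDist x Uᶜ) with h' | h'
      · simp only [h'] at h; norm_num at h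
      · simp only [h'] at h; exact h
    · intro h; simp [h]
  have hdc : Continuous d := continuous_const.min (Metric.continuous_infDist_pt _)
  have hdl : ∀ x y, d x ≤ d y + |x - y| := by
    intro x y
    have h1 : Metric.infDist x Uᶜ ≤ Metric.infDist y Uᶜ + dist x y :=
      Metric.infDist_le_infDist_add_dist
    rw [Real.dist_eq] at h1
    have := abs_nonneg (x - y)
    simp only [hd]
    rw [← min_add_add_right]
    exact min_le_min (by linarith) h1
  set δ := c / (2 * N + 1) with hδ
  have hδ0 : 0 < δ := by positivity
  have hδc : δ ≤ c := div_le_self hc.le (by linarith)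
  have hNδ : 2 * N * δ ≤ c := by
    have : δ * (2 * N + 1) = c := div_mul_cancel₀ _ (by positivity)
    nlinarith
  obtain ⟨P, hPc, hPE, hPU, hPd⟩ := exists_P E hT d hdl hdc hd0 hd1
    (fun x hx => lt_of_le_of_ne (hd0 x) fun h => (hdU x).mp h.symm (hEU hx)) δ hδ0
    (hδc.trans hc1)
  have hPpos : ∀ x, x ∉ P → 0 < d x := fun x hx =>
    lt_of_le_of_ne (hd0 x) fun h => hx (hPU x h.symm)
  have hgap : ∀ x, ∃ a b, x ∉ P → a ∈ P ∧ b ∈ P ∧ a < x ∧ x < b ∧ b - a ≤ δ * d x ∧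
      ∀ z ∈ Ioo a b, z ∉ P := by
    intro x
    by_cases hx : x ∈ P
    · exact ⟨0, 0, fun h => absurd hx h⟩
    · obtain ⟨p, hp, p', hp', h1, h2, h3⟩ := hPd x (hPpos x hx)
      obtain ⟨a, ha, b, hb, h4, h5, h6, h7, h8⟩ := exists_gap P hPc x p p' hp hp' h1 h2 hx
      exact ⟨a, b, fun _ => ⟨ha, hb, h6, h7, by linarith, h8⟩⟩
  choose A B hAB using hgap
  have huniq : ∀ x, x ∉ P → ∀ z ∈ Ioo (A x) (B x), A z = A x ∧ B z = B x := by
    intro x hx z hz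
    obtain ⟨h1, h2, h3, h4, _, h5⟩ := hAB x hx
    obtain ⟨k1, k2, k3, k4, _, k5⟩ := hAB z (h5 z hz)
    constructor
    · apply le_antisymm
      · by_contra h; push Not at h
        exact h5 _ ⟨h, k3.trans hz.2⟩ k1
      · by_contra h; push Not at h
        exact k5 _ ⟨h, hz.1.trans k4⟩ h1
    · apply le_antisymm
      · by_contra h; push Not at h
        exact k5 _ ⟨k3.trans hz.2, h⟩ h2
      · by_contra h; push Not at h
        exact h5 _ ⟨hz.1.trans k4, h⟩ k2
  have hbump : ∀ a b : ℝ, ∃ φ : ℝ → ℝ, a < b → (∃ C : ℝ, ∀ y z, |φ y - φ z| ≤ C * |y - z|) ∧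
      (∀ y, 0 ≤ φ y ∧ φ y ≤ 2 * N * (b - a)) ∧
      (∀ y, φ y ≠ 0 → a + (b - a) / 3 ≤ y ∧ y ≤ b - (b - a) / 3) ∧
      (∃ y ∈ Ioo a b, φ y = 2 * N * (b - a)) ∧
      (∀ x ∈ E, ∀ᶠ z in 𝓝 x, φ z = φ x) := by
    intro a b
    by_cases hab : a < b
    · obtain ⟨φ, hφ⟩ := exists_bump E hE hT a b (2 * N * (b - a)) hab
        (by have : 0 < b - a := by linarith
            positivity)
      exact ⟨φ, fun _ => hφ⟩
    · exact ⟨0, fun h => absurd h hab⟩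
  choose φ hφ using hbump
  classical
  set g : ℝ → ℝ := fun y => if y ∈ P then 0 else φ (A y) (B y) y with hg
  have hgP : ∀ y ∈ P, g y = 0 := fun y hy => by simp [hg, hy]
  have hgx : ∀ x, x ∉ P → ∀ z ∈ Ioo (A x) (B x), g z = φ (A x) (B x) z := by
    intro x hx z hz
    have hzP := (hAB x hx).2.2.2.2.2 z hz
    obtain ⟨h1, h2⟩ := huniq x hx z hz
    simp [hg, hzP, h1, h2]
  have hself : ∀ x, x ∉ P → x ∈ Ioo (A x) (B x) := fun x hx =>
    ⟨(hAB x hx).2.2.1, (hAB x hx).2.2.2.1⟩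
  have hlt : ∀ x, x ∉ P → A x < B x := fun x hx => (hself x hx).1.trans (hself x hx).2
  have hgd : ∀ y, |g y| ≤ c * d y := by
    intro y
    by_cases hy : y ∈ P
    · rw [hgP y hy, abs_zero]
      exact mul_nonneg hc.le (hd0 y)
    · rw [hgx y hy y (hself y hy)]
      obtain ⟨h1, h2⟩ := (hφ _ _ (hlt y hy)).2.1 y
      rw [abs_of_nonneg h1]
      refine h2.trans ?_
      calc 2 * N * (B y - A y) ≤ 2 * N * (δ * d y) := by
            gcongr
            exact (hAB y hy).2.2.2.2.1
        _ = (2 * N * δ) * d y := by ring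
        _ ≤ c * d y := by
            gcongr
            exact hd0 y
  set W : Set ℝ := {x | ∀ᶠ z in 𝓝 x, g z = g x} with hW
  have hWo : IsOpen W := by
    rw [isOpen_iff_mem_nhds]
    intro x hx
    have hx' : ∀ᶠ z in 𝓝 x, g z = g x := hx
    filter_upwards [hx'.eventually_nhds] with z hz
    have h1 := hz.self_of_nhds
    show ∀ᶠ w in 𝓝 z, g w = g z
    filter_upwards [hz] with w hw
    rw [hw, h1]
  have hPU' : Pᶜ ⊆ U := by
    intro x hx
    by_contra h
    exact hx (hPU x ((hdU x).mpr h))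
  refine ⟨g, Pᶜ ∩ W ∩ O, (hPc.isOpen_compl.inter hWo).inter hO, ?_, ?_, ?_, ?_, ?_, ?_, ?_, ?_⟩
  · intro x hx
    have hxP : x ∉ P := fun h => hPE x h hx
    refine ⟨⟨hxP, ?_⟩, hEO hx⟩
    show ∀ᶠ z in 𝓝 x, g z = g x
    filter_upwards [(hφ _ _ (hlt x hxP)).2.2.2.2 x hx,
      Ioo_mem_nhds (hself x hxP).1 (hself x hxP).2] with z h1 h2
    rw [hgx x hxP z h2, hgx x hxP x (hself x hxP), h1]
  · exact fun x hx => hPU' hx.1.1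
  · exact fun x hx => hx.2
  · obtain ⟨u, hu⟩ := hUn
    exact ⟨u, fun h => hu (hPU' h.1.1)⟩
  · intro y
    refine ⟨(hgd y).trans (mul_le_of_le_one_right hc.le (hd1 y)), (hgd y).trans ?_⟩
    gcongr
    exact min_le_right _ _
  · intro x
    by_cases hx : x ∈ P
    · refine ⟨6 * N, Eventually.of_forall fun y => ?_⟩
      rw [hgP x hx, sub_zero]
      by_cases hy : y ∈ P
      · rw [hgP y hy, abs_zero]; positivity
      · rw [hgx y hy y (hself y hy)]
        obtain ⟨_, hb, hs, _, _⟩ := hφ _ _ (hlt y hy)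
        by_cases h0 : φ (A y) (B y) y = 0
        · rw [h0, abs_zero]; positivity
        · have h1 := hs y h0
          rw [abs_of_nonneg (hb y).1]
          refine (hb y).2.trans ?_
          have h2 : (B y - A y) / 3 ≤ |y - x| := by
            rcases le_or_gt x (A y) with h | h
            · exact le_trans (by linarith) (le_abs_self _)
            · rcases le_or_gt (B y) x with h' | h'
              · exact le_trans (by linarith) (neg_le_abs _)
              · exact absurd hx ((hAB y hy).2.2.2.2.2 x ⟨h, h'⟩)
          nlinarith
    · obtain ⟨⟨C, hC⟩, _⟩ := hφ _ _ (hlt x hx)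
      refine ⟨C, ?_⟩
      filter_upwards [Ioo_mem_nhds (hself x hx).1 (hself x hx).2] with z h2
      rw [hgx x hx z h2, hgx x hx x (hself x hx)]
      exact hC z x
  · exact fun x hx => hx.1.2
  · intro x hxE
    have hx : x ∉ P := fun h => hPE x h hxE
    obtain ⟨k1, k2, k3, k4, k5, k6⟩ := hAB x hx
    refine ⟨A x, B x, k3, k4, ?_, fun z hz => hPU' (k6 z hz), fun h => h.1.1 k1,
      fun h => h.1.1 k2, ?_⟩
    · calc B x - A x ≤ δ * d x := k5
        _ ≤ δ := mul_le_of_le_one_right hδ0.le (hd1 x)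
        _ ≤ c := hδc
    · obtain ⟨_, hb, hs, ⟨y, hy, hyh⟩, _⟩ := hφ _ _ (hlt x hx)
      have hx0 := hb x
      rw [hgx x hx x (hself x hx)]
      rcases le_total (φ (A x) (B x) x) (N * (B x - A x)) with h | h
      · refine ⟨y, hy, ?_⟩
        rw [hgx x hx y hy, hyh]
        exact le_trans (by linarith) (le_abs_self _)
      · have hm : A x + (B x - A x) / 4 ∈ Ioo (A x) (B x) := ⟨by linarith, by linarith⟩
        refine ⟨A x + (B x - A x) / 4, hm, ?_⟩
        rw [hgx x hx _ hm]
        have : φ (A x) (B x) (A x + (B x - A x) / 4) = 0 := by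
          by_contra h'
          have := (hs _ h').1
          linarith
        rw [this]
        exact le_trans (by linarith) (neg_le_abs _)

/-- Tail estimate for series dominated by a geometric one. -/
theorem tsum_tail_bound (t : ℕ → ℝ) (n : ℕ) (A : ℝ)
    (ht : ∀ m, |t (m + n)| ≤ A * (1 / 2) ^ (m + n)) :
    Summable t ∧ |∑' m, t (m + n)| ≤ 2 * A * (1 / 2) ^ n := by
  have hs : HasSum (fun m : ℕ => A * (1 / 2 : ℝ) ^ (m + n)) (2 * A * (1 / 2) ^ n) := by
    have h := hasSum_geometric_two.mul_left (A * (1 / 2 : ℝ) ^ n)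
    have e1 : (fun m : ℕ => A * (1 / 2 : ℝ) ^ (m + n)) =
        fun m : ℕ => A * (1 / 2 : ℝ) ^ n * (1 / 2) ^ m := by
      funext m; rw [pow_add]; ring
    rw [e1, show 2 * A * (1 / 2 : ℝ) ^ n = A * (1 / 2 : ℝ) ^ n * 2 by ring]
    exact h
  constructor
  · rw [← summable_nat_add_iff n]
    exact Summable.of_norm_bounded hs.summable ht
  · exact tsum_of_norm_bounded (f := fun m => t (m + n)) hs ht

theorem const_of_locally (g : ℝ → ℝ) (a b : ℝ)
    (h : ∀ x ∈ Ioo a b, ∀ᶠ z in 𝓝 x, g z = g x) (x y : ℝ) (hx : x ∈ Ioo a b)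
    (hy : y ∈ Ioo a b) : g x = g y := by
  have hd : ∀ z ∈ Ioo a b, HasDerivAt g 0 z := fun z hz =>
    (hasDerivAt_const z (g z)).congr_of_eventuallyEq (h z hz)
  exact isOpen_Ioo.is_const_of_deriv_eq_zero isPreconnected_Ioo
    (fun z hz => (hd z hz).differentiableAt.differentiableWithinAt)
    (fun z hz => (hd z hz).deriv) hx hy

theorem exists_seq (E : Set ℝ) (hGδ : IsGδ E) (hT : Trim E) :
    ∃ (U : ℕ → Set ℝ) (g : ℕ → ℝ → ℝ), (∀ n, IsOpen (U n)) ∧ (∀ n, E ⊆ U n) ∧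
      (∀ n, (U n)ᶜ.Nonempty) ∧ Antitone U ∧ (∀ x, (∀ n, x ∈ U n) → x ∈ E) ∧
      (∀ n y, |g n y| ≤ (1 / 2) ^ n ∧ |g n y| ≤ (1 / 2) ^ n * Metric.infDist y (U n)ᶜ) ∧
      (∀ n x, ∃ C, ∀ᶠ y in 𝓝 x, |g n y - g n x| ≤ C * |y - x|) ∧
      (∀ n, ∀ x ∈ U (n + 1), ∀ᶠ z in 𝓝 x, g n z = g n x) ∧
      (∀ n, ∀ x ∈ E, ∃ a b, a < x ∧ x < b ∧ b - a ≤ (1 / 2) ^ n ∧ Ioo a b ⊆ U n ∧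
        a ∉ U (n + 1) ∧ b ∉ U (n + 1) ∧
        ∃ y ∈ Ioo a b, (n : ℝ) * (b - a) ≤ |g n y - g n x|) := by
  have hE := hGδ.measurableSet
  obtain ⟨O, hO, hEO⟩ := isGδ_iff_eq_iInter_nat.mp hGδ
  have hEO' : ∀ n, E ⊆ O n := fun n => by rw [hEO]; exact iInter_subset _ n
  have hstep := fun (n : ℕ) (U : {U : Set ℝ // IsOpen U ∧ E ⊆ U ∧ Uᶜ.Nonempty}) =>
    exists_next E hE hT U.1 (O n) U.2.1 U.2.2.1 U.2.2.2 (hO n) (hEO' n) ((1 / 2) ^ n) n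
      (by positivity) (pow_le_one₀ (by norm_num) (by norm_num)) (by positivity)
  choose g V h1 h2 h3 h4 h5 h6 h7 h8 h9 using hstep
  obtain ⟨p, _, hp⟩ := exists_notMem E hT 0 1 zero_lt_one
  let S : ℕ → {U : Set ℝ // IsOpen U ∧ E ⊆ U ∧ Uᶜ.Nonempty} := fun n =>
    Nat.rec ⟨{p}ᶜ, isOpen_compl_singleton, fun x hx h => hp (h ▸ hx), ⟨p, by simp⟩⟩
      (fun n U => ⟨V n U, h1 n U, h2 n U, h5 n U⟩) n
  have hS : ∀ n, (S (n + 1)).1 = V n (S n) := fun n => rfl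
  refine ⟨fun n => (S n).1, fun n => g n (S n), fun n => (S n).2.1, fun n => (S n).2.2.1,
    fun n => (S n).2.2.2, antitone_nat_of_succ_le fun n => h3 n (S n), ?_, fun n => h6 n (S n),
    fun n => h7 n (S n), fun n => h8 n (S n), fun n => h9 n (S n)⟩
  intro x hx
  rw [hEO, mem_iInter]
  exact fun n => h4 n (S n) (hx (n + 1))

/-- If `E ⊆ ℝ` is a trim `G_δ` set, then there is a continuous `f : ℝ → ℝ` with
`L_f^∞ = E`, `l_f^∞ = ∅`, and `lip f(x) = 0` for all `x ∈ E`. -/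
theorem exists_continuous_of_trim_Gdelta (E : Set ℝ) (hGδ : IsGδ E) (hTrim : Trim E) :
    ∃ f : ℝ → ℝ, Continuous f ∧ {x : ℝ | bigLip f x = ⊤} = E ∧
      (∀ x : ℝ, litLip f x ≠ ⊤) ∧ (∀ x ∈ E, litLip f x = 0) := by
  obtain ⟨U, g, hUo, hEU, hUn, hanti, hcap, hgb, hgl, hgc, hgE⟩ := exists_seq E hGδ hTrim
  have hsum : ∀ y, Summable fun n => g n y := fun y =>
    (tsum_tail_bound (fun n => g n y) 0 1 (fun m => by simpa using (hgb m y).1)).1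
  set f : ℝ → ℝ := fun y => ∑' n, g n y with hf
  have hgcont : ∀ n, Continuous (g n) := by
    intro n
    rw [continuous_iff_continuousAt]
    intro x
    obtain ⟨C, hC⟩ := hgl n x
    rw [ContinuousAt, tendsto_iff_norm_sub_tendsto_zero]
    refine squeeze_zero' (Eventually.of_forall fun _ => norm_nonneg _) hC ?_
    have : Continuous fun y : ℝ => C * |y - x| := by fun_prop
    simpa using this.tendsto x
  have hfc : Continuous f :=
    continuous_tsum hgcont summable_geometric_two fun n y => (hgb n y).1
  have hdiff : ∀ n x y, f y - f x =
      ∑ i ∈ Finset.range n, (g i y - g i x) + ∑' m, (g (m + n) y - g (m + n) x) := by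
    intro n x y
    have h := ((hsum y).sub (hsum x)).sum_add_tsum_nat_add n
    rw [h, hf, (hsum y).tsum_sub (hsum x)]
  have hgU : ∀ m n x y, n ≤ m → x ∉ U n → |g m y| ≤ (1 / 2) ^ m * |y - x| := by
    intro m n x y hnm hx
    refine (hgb m y).2.trans ?_
    gcongr
    rw [← Real.dist_eq]
    exact Metric.infDist_le_dist_of_mem fun h => hx (hanti hnm h)
  have hconst : ∀ n a b x y, Ioo a b ⊆ U n → x ∈ Ioo a b → y ∈ Ioo a b →
      ∑ i ∈ Finset.range n, (g i y - g i x) = 0 := by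
    intro n a b x y hab hx hy
    refine Finset.sum_eq_zero fun i hi => ?_
    rw [sub_eq_zero]
    refine const_of_locally (g i) a b (fun z hz => hgc i z ?_) y x hy hx
    exact hanti (Nat.succ_le_of_lt (Finset.mem_range.mp hi)) (hab hz)
  -- off `E`, the big Lip constant is finite
  have hfin : ∀ x, x ∉ E → bigLip f x ≠ ⊤ := by
    intro x hx
    obtain ⟨n, hn⟩ : ∃ n, x ∉ U n := by
      by_contra! h
      exact hx (hcap x h)
    choose C hC using fun i => hgl i x
    have hev : ∀ᶠ y in 𝓝 x, |f y - f x| ≤ (∑ i ∈ Finset.range n, |C i| + 2) * |y - x| := by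
      have h1 : ∀ᶠ y in 𝓝 x, ∀ i ∈ Finset.range n, |g i y - g i x| ≤ C i * |y - x| :=
        (Filter.eventually_all_finset _).mpr fun i _ => hC i
      filter_upwards [h1] with y hy
      have ht := (tsum_tail_bound (fun m => g m y - g m x) n |y - x| (fun m => by
        have h2 := hgU (m + n) n x y (by omega) hn
        have h3 := hgU (m + n) n x x (by omega) hn
        rw [sub_self, abs_zero, mul_zero] at h3
        have h4 : g (m + n) x = 0 := abs_nonpos_iff.mp h3
        rw [h4, sub_zero, mul_comm]
        exact h2)).2
      have hp : (1 / 2 : ℝ) ^ n ≤ 1 := pow_le_one₀ (by norm_num) (by norm_num)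
      have hs : |∑ i ∈ Finset.range n, (g i y - g i x)| ≤
          (∑ i ∈ Finset.range n, |C i|) * |y - x| := by
        rw [Finset.sum_mul]
        refine (Finset.abs_sum_le_sum_abs _ _).trans (Finset.sum_le_sum fun i hi => ?_)
        refine (hy i hi).trans ?_
        gcongr
        exact le_abs_self _
      rw [hdiff n x y]
      refine (abs_add_le _ _).trans ?_
      rw [add_mul]
      refine add_le_add hs (ht.trans ?_)
      exact mul_le_of_le_one_right (by positivity) hp
    set D := ∑ i ∈ Finset.range n, |C i| + 2 with hD
    have hD0 : 0 ≤ D := by positivity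
    obtain ⟨ε, hε, hball⟩ := Metric.eventually_nhds_iff.mp hev
    have hle : bigLip f x ≤ ENNReal.ofReal D := by
      refine limsup_le_of_le (by isBoundedDefault) ?_
      filter_upwards [Ioo_mem_nhdsGT hε] with r hr
      refine iSup₂_le fun y hy => ?_
      apply ENNReal.ofReal_le_ofReal
      rw [div_le_iff₀ hr.1]
      have hy' : |y - x| ≤ r := by rw [abs_sub_comm]; exact hy
      have := hball (y := y) (by rw [Real.dist_eq]; exact lt_of_le_of_lt hy' hr.2)
      rw [abs_sub_comm]
      exact this.trans (by gcongr)
    exact ne_top_of_le_ne_top ENNReal.ofReal_ne_top hle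
  have hhalf : ∀ ε : ℝ, 0 < ε → ∃ n0 : ℕ, ∀ n ≥ n0, (1 / 2 : ℝ) ^ n < ε := by
    intro ε hε
    obtain ⟨n0, h0⟩ := exists_pow_lt_of_lt_one hε (by norm_num : (1 / 2 : ℝ) < 1)
    exact ⟨n0, fun n hn =>
      lt_of_le_of_lt (pow_le_pow_of_le_one (by norm_num) (by norm_num) hn) h0⟩
  -- on `E`, the big Lip constant is infinite
  have htop : ∀ x ∈ E, bigLip f x = ⊤ := by
    intro x hx
    refine ENNReal.eq_top_of_forall_nnreal_le fun R => ?_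
    refine le_limsup_of_frequently_le ?_ (by isBoundedDefault)
    rw [(nhdsGT_basis (0 : ℝ)).frequently_iff]
    intro ε hε
    obtain ⟨n0, hn0⟩ := hhalf ε hε
    obtain ⟨n1, hn1⟩ := exists_nat_ge ((R : ℝ) + 4)
    set n := max n0 n1 with hn
    have hnR : (R : ℝ) + 4 ≤ n := hn1.trans (by exact_mod_cast le_max_right _ _)
    obtain ⟨a, b, hax, hxb, hba, hsub, ha, hb, y, hy, hyN⟩ := hgE n x hx
    have hr : 0 < b - a := by linarith
    refine ⟨b - a, ⟨hr, lt_of_le_of_lt hba (hn0 n (le_max_left _ _))⟩, ?_⟩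
    have hdy : |x - y| ≤ b - a := by
      rw [abs_le]; constructor <;> linarith [hy.1, hy.2]
    have ht := (tsum_tail_bound (fun m => g m y - g m x) (n + 1) (2 * (b - a)) (fun m => by
        have h2 := hgU (m + (n + 1)) (n + 1) a y (by omega) ha
        have h3 := hgU (m + (n + 1)) (n + 1) a x (by omega) ha
        have hp : (0 : ℝ) < (1 / 2) ^ (m + (n + 1)) := by positivity
        have h4 : |y - a| ≤ b - a := by rw [abs_of_pos (by linarith [hy.1])]; linarith [hy.2]
        have h5 : |x - a| ≤ b - a := by rw [abs_of_pos (by linarith)]; linarith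
        refine (abs_sub _ _).trans ?_
        nlinarith)).2
    have hp : (1 / 2 : ℝ) ^ (n + 1) ≤ 1 := pow_le_one₀ (by norm_num) (by norm_num)
    have ht' : |∑' m, (g (m + (n + 1)) y - g (m + (n + 1)) x)| ≤ 4 * (b - a) :=
      ht.trans (by nlinarith)
    have hfd := hdiff (n + 1) x y
    rw [Finset.sum_range_succ, hconst n a b x y hsub ⟨hax, hxb⟩ hy, zero_add] at hfd
    have hbig : R * (b - a) ≤ |f x - f y| := by
      rw [abs_sub_comm, hfd]
      have h6 := abs_sub_abs_le_abs_add (g n y - g n x)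
        (∑' m, (g (m + (n + 1)) y - g (m + (n + 1)) x))
      nlinarith
    refine le_trans ?_ (le_iSup₂ (f := fun y (_ : y ∈ {y : ℝ | |x - y| ≤ b - a}) =>
      ENNReal.ofReal (|f x - f y| / (b - a))) y hdy)
    rw [← ENNReal.ofReal_coe_nnreal]
    apply ENNReal.ofReal_le_ofReal
    rwa [le_div_iff₀ hr]
  -- on `E`, the little lip constant vanishes
  have hzero : ∀ x ∈ E, litLip f x = 0 := by
    intro x hx
    rw [← nonpos_iff_eq_zero]
    refine ENNReal.le_of_forall_pos_le_add fun η hη _ => ?_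
    rw [zero_add]
    refine liminf_le_of_frequently_le ?_ (by isBoundedDefault)
    rw [(nhdsGT_basis (0 : ℝ)).frequently_iff]
    intro ε hε
    obtain ⟨n0, hn0⟩ := hhalf ε hε
    obtain ⟨n1, hn1⟩ := hhalf ((η : ℝ) / 12) (by positivity)
    set n := max n0 n1 with hn
    obtain ⟨a, b, hax, hxb, hba, hsub, ha, hb, -⟩ := hgE n x hx
    set R := Metric.infDist x (U (n + 1))ᶜ with hR
    have hR0 : 0 < R :=
      ((hUo (n + 1)).isClosed_compl.notMem_iff_infDist_pos (hUn (n + 1))).mp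
        (fun h => h (hEU (n + 1) hx))
    have hRa : R ≤ b - a := by
      refine (Metric.infDist_le_dist_of_mem (show a ∈ (U (n + 1))ᶜ from ha)).trans ?_
      rw [Real.dist_eq, abs_of_pos (by linarith)]; linarith
    have hε' := hn0 n (le_max_left _ _)
    have hη' := hn1 n (le_max_right _ _)
    refine ⟨R / 2, ⟨by positivity, by linarith⟩, ?_⟩
    refine iSup₂_le fun y hy => ?_
    rw [← ENNReal.ofReal_coe_nnreal]
    apply ENNReal.ofReal_le_ofReal
    rw [div_le_iff₀ (by positivity)]
    have hy1 : |x - y| ≤ R / 2 := hy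
    have hy' := abs_le.mp hy1
    have hI : Ioo (x - R) (x + R) ⊆ U (n + 1) := by
      intro z hz
      by_contra h
      have h1 : R ≤ dist x z := Metric.infDist_le_dist_of_mem (show z ∈ (U (n + 1))ᶜ from h)
      have h2 : dist x z < R := by
        rw [Real.dist_eq, abs_lt]; constructor <;> linarith [hz.1, hz.2]
      linarith
    have hgm : ∀ m, ∀ z, |x - z| ≤ R / 2 → |g (m + (n + 1)) z| ≤
        (1 / 2) ^ (m + (n + 1)) * (3 / 2 * R) := by
      intro m z hz
      refine (hgb _ z).2.trans ?_
      gcongr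
      have h1 : Metric.infDist z (U (m + (n + 1)))ᶜ ≤ Metric.infDist z (U (n + 1))ᶜ :=
        Metric.infDist_le_infDist_of_subset
          (compl_subset_compl.mpr (hanti (by omega))) (hUn _)
      have h2 : Metric.infDist z (U (n + 1))ᶜ ≤ R + dist z x :=
        Metric.infDist_le_infDist_add_dist
      rw [dist_comm, Real.dist_eq] at h2
      linarith
    have ht := (tsum_tail_bound (fun m => g m y - g m x) (n + 1) (3 * R) (fun m => by
        have h2 := hgm m y hy1
        have h3 := hgm m x (by rw [sub_self, abs_zero]; positivity)
        refine (abs_sub _ _).trans ?_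
        linarith)).2
    have hfd := hdiff (n + 1) x y
    rw [hconst (n + 1) _ _ x y hI ⟨by linarith, by linarith⟩ ⟨by linarith, by linarith⟩,
      zero_add] at hfd
    rw [abs_sub_comm, hfd]
    refine ht.trans ?_
    rw [pow_succ]
    nlinarith
  refine ⟨f, hfc, ?_, ?_, hzero⟩
  · ext x
    refine ⟨fun h => ?_, fun h => htop x h⟩
    by_contra hx
    exact hfin x hx h
  · intro x
    by_cases hx : x ∈ E
    · rw [hzero x hx]; exact ENNReal.zero_ne_top
    · refine ne_top_of_le_ne_top (hfin x hx) ?_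
      exact liminf_le_limsup
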